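/- arXiv:2209.13867 — 5 statements merged into one kernel-verified Lean document; each statement's English description precedes it below -/
import Mathlib

section
/- Let q ≥ 10 be an integer satisfying q ≡ 2 or 3 (mod 4), and let ℓ = C(q,2) = q(q−1)/2. For every integer k ≥ 1 and n = (ℓ+1)^k, there exists a completely balanced edge-coloring of the complete graph K_n with ℓ colors that contains no rainbow copy of K_q. -/
/-- A set `S` of vertices is rainbow under an edge-coloring `c` if all edges with both
endpoints in `S` receive pairwise distinct colors. -/
def IsRainbow {V C : Type*} (c : V → V → C) (S : Finset V) : Prop :=
  ∀ a ∈ S, ∀ b ∈ S, ∀ a' ∈ S, ∀ b' ∈ S,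
    a ≠ b → a' ≠ b' → c a b = c a' b' → (a = a' ∧ b = b') ∨ (a = b' ∧ b = a')

/-- The coloring `c` contains a rainbow copy of `K_q`. -/
def HasRainbowClique {V C : Type*} (c : V → V → C) (q : ℕ) : Prop :=
  ∃ S : Finset V, S.card = q ∧ IsRainbow c S

/-- An edge-coloring of `K_n` with `l` colors is completely balanced if every vertex
is incident to exactly `(n-1)/l` edges of each color; in particular `l` divides `n-1`. -/
def IsCompletelyBalanced {n l : ℕ} (c : Fin n → Fin n → Fin l) : Prop :=
  ∃ d : ℕ, n - 1 = l * d ∧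
    ∀ v : Fin n, ∀ k : Fin l,
      (Finset.univ.filter fun u => u ≠ v ∧ c v u = k).card = d

/-- A symmetric edge-coloring in which every vertex sees every color equally often, and which
has no rainbow `q`-clique, exists on the vertex type `V` with color type `C`. -/
def HasBalancedColoring (V C : Type) [Fintype V] [DecidableEq V] [DecidableEq C] (q : ℕ) :
    Prop :=
  ∃ c : V → V → C, (∀ a b, c a b = c b a) ∧
    (∃ d : ℕ, ∀ v k, (Finset.univ.filter fun u => u ≠ v ∧ c v u = k).card = d) ∧
    ¬ HasRainbowClique c q

theorem IsRainbow.image {V V' C C' : Type*} [DecidableEq V'] {c : V → V → C}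
    {c' : V' → V' → C'} {S : Finset V} (hS : IsRainbow c S) (f : V → V')
    (h : ∀ a ∈ S, ∀ b ∈ S, ∀ a' ∈ S, ∀ b' ∈ S, f a ≠ f b → f a' ≠ f b' →
      c' (f a) (f b) = c' (f a') (f b') → c a b = c a' b') :
    IsRainbow c' (S.image f) := by
  simp only [IsRainbow, Finset.forall_mem_image]
  intro a ha b hb a' ha' b' hb' hab hab' hc
  rcases hS a ha b hb a' ha' b' hb' (ne_of_apply_ne f hab) (ne_of_apply_ne f hab')
    (h a ha b hb a' ha' b' hb' hab hab' hc) with ⟨rfl, rfl⟩ | ⟨rfl, rfl⟩ <;> simp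

theorem HasBalancedColoring.congr {V V' C C' : Type} [Fintype V] [DecidableEq V]
    [DecidableEq C] [Fintype V'] [DecidableEq V'] [DecidableEq C'] {q : ℕ}
    (h : HasBalancedColoring V C q) (e : V ≃ V') (g : C ≃ C') :
    HasBalancedColoring V' C' q := by
  obtain ⟨c, hsymm, ⟨d, hd⟩, hq⟩ := h
  refine ⟨fun a b => g (c (e.symm a) (e.symm b)), fun a b => congrArg g (hsymm _ _),
    ⟨d, fun v k => ?_⟩, ?_⟩
  · rw [← hd (e.symm v) (g.symm k)]
    refine Finset.card_equiv e.symm fun u => ?_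
    simp [Equiv.eq_symm_apply]
  · rintro ⟨S, hS, hr⟩
    refine hq ⟨S.image e.symm, by rw [Finset.card_image_of_injective _ e.symm.injective, hS],
      hr.image _ fun a _ b _ a' _ b' _ _ _ hc => by rw [hc]⟩

/-- The lexicographic product of two colorings. -/
theorem HasBalancedColoring.prod {W U C : Type} [Fintype W] [DecidableEq W] [Fintype U]
    [DecidableEq U] [DecidableEq C] {q : ℕ}
    (hW : HasBalancedColoring W C q) (hU : HasBalancedColoring U C q) :
    HasBalancedColoring (W × U) C q := by
  obtain ⟨c₁, hsymm₁, ⟨d₁, hd₁⟩, hq₁⟩ := hW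
  obtain ⟨c₂, hsymm₂, ⟨d₂, hd₂⟩, hq₂⟩ := hU
  refine ⟨fun x y => if x.1 = y.1 then c₂ x.2 y.2 else c₁ x.1 y.1, fun a b => ?_,
    ⟨d₂ + d₁ * Fintype.card U, fun v k => ?_⟩, ?_⟩
  · simp only [eq_comm (a := a.1), hsymm₁ a.1, hsymm₂ a.2]
  · have hsplit : (Finset.univ.filter fun u : W × U =>
        u ≠ v ∧ (if v.1 = u.1 then c₂ v.2 u.2 else c₁ v.1 u.1) = k) =
        ({v.1} ×ˢ Finset.univ.filter fun u => u ≠ v.2 ∧ c₂ v.2 u = k) ∪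
        ((Finset.univ.filter fun w => w ≠ v.1 ∧ c₁ v.1 w = k) ×ˢ Finset.univ) := by
      ext ⟨w, u⟩
      obtain ⟨v, v'⟩ := v
      by_cases hw : w = v
      · subst hw; simp
      · simp [hw, Ne.symm hw]
    rw [hsplit, Finset.card_union_of_disjoint, Finset.card_product, Finset.card_product,
      hd₁, hd₂, Finset.card_singleton, one_mul, Finset.card_univ]
    rw [Finset.disjoint_left]
    rintro ⟨w, u⟩ h₁ h₂
    simp only [Finset.mem_product, Finset.mem_singleton, Finset.mem_filter] at h₁ h₂
    exact h₂.1.2.1 h₁.1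
  · rintro ⟨S, hS, hr⟩
    by_cases hinj : Set.InjOn Prod.fst (S : Set (W × U))
    · refine hq₁ ⟨S.image Prod.fst, by rw [Finset.card_image_of_injOn hinj, hS],
        hr.image _ fun a _ b _ a' _ b' _ hab hab' hc => ?_⟩
      simpa [hab, hab'] using hc
    · simp only [Set.InjOn, Finset.mem_coe] at hinj
      push Not at hinj
      obtain ⟨x, hx, y, hy, hxy, hne⟩ := hinj
      have hconst : ∀ z ∈ S, z.1 = x.1 := by
        intro z hz
        by_contra hzx
        have hxz : x ≠ z := fun h => hzx (by rw [h])
        have hyz : y ≠ z := fun h => hzx (by rw [hxy, h])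
        rcases hr x hx z hz y hy z hz hxz hyz (by simp [← hxy, Ne.symm hzx]) with h | h
        · exact hne h.1
        · exact hxz h.1
      have hfst : ∀ a ∈ S, ∀ b ∈ S, a.1 = b.1 := fun a ha b hb =>
        (hconst a ha).trans (hconst b hb).symm
      refine hq₂ ⟨S.image Prod.snd, ?_,
        hr.image _ fun a ha b hb a' ha' b' hb' _ _ hc => ?_⟩
      · rw [Finset.card_image_of_injOn, hS]
        exact fun a ha b hb h => Prod.ext (hfst a ha b hb) h
      · simpa [hfst a ha b hb, hfst a' ha' b' hb'] using hc

/-- Weak Sidon sets in abelian groups of odd order are small. -/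
theorem IsRainbow.card_mul_le {G : Type*} [AddCommGroup G] [Fintype G] [DecidableEq G]
    (hG : ∀ x y : G, x + x = y + y → x = y) {T : Finset G}
    (hT : IsRainbow (fun x y : G => x + y) T) :
    T.card * (T.card - 3) ≤ Fintype.card G := by
  set P := T.sigma fun b => T.filter fun a => b + b - a ∉ T with hP
  have hlower : ∀ b ∈ T, T.card - 3 ≤ (T.filter fun a => b + b - a ∉ T).card := by
    intro b hb
    have hbad : (T.filter fun a => b + b - a ∈ T).card ≤ 3 := by
      by_cases h : ∃ a ∈ T, b + b - a ∈ T ∧ a ≠ b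
      · obtain ⟨a, ha, ha', hab⟩ := h
        refine (Finset.card_le_card (t := {b, a, b + b - a}) fun x hx => ?_).trans
          Finset.card_le_three
        obtain ⟨hx, hx'⟩ := Finset.mem_filter.1 hx
        have hne : ∀ y, y ≠ b → y ≠ b + b - y := fun y hy h =>
          hy (hG _ _ (eq_sub_iff_add_eq.1 h))
        simp only [Finset.mem_insert, Finset.mem_singleton]
        by_cases hxb : x = b
        · exact Or.inl hxb
        · rcases hT x hx _ hx' a ha _ ha' (hne x hxb) (hne a hab) (by simp) with h | h
          · exact Or.inr (Or.inl h.1)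
          · exact Or.inr (Or.inr h.1)
      · push Not at h
        refine (Finset.card_le_card (t := {b}) fun x hx => ?_).trans (by simp)
        obtain ⟨hx, hx'⟩ := Finset.mem_filter.1 hx
        exact Finset.mem_singleton.2 (h x hx hx')
    have := Finset.card_filter_add_card_filter_not (s := T) fun a => b + b - a ∈ T
    omega
  have hcard : T.card * (T.card - 3) ≤ P.card := by
    rw [hP, Finset.card_sigma, ← smul_eq_mul]
    exact Finset.card_nsmul_le_sum _ _ _ hlower
  refine hcard.trans ?_
  rw [← Finset.card_univ]
  refine Finset.card_le_card_of_injOn (fun p => p.2 - p.1) (fun _ _ => Finset.mem_coe.2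
    (Finset.mem_univ _)) ?_
  rintro ⟨b, a⟩ hp ⟨e, c⟩ hp' h
  simp only [hP, Finset.mem_coe, Finset.mem_sigma, Finset.mem_filter] at hp hp' h
  obtain ⟨hb, ha, hab⟩ := hp
  obtain ⟨he, hc, hce⟩ := hp'
  have hsum : a + e = c + b := by rwa [sub_eq_sub_iff_add_eq_add] at h
  have hae : a ≠ e := by
    rintro rfl
    exact hce (by rwa [hsum, add_sub_cancel_left])
  have hcb : c ≠ b := by
    rintro rfl
    exact hab (by rwa [← hsum, add_sub_cancel_left])
  rcases hT a ha e he c hc b hb hae hcb hsum with ⟨rfl, rfl⟩ | ⟨rfl, rfl⟩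
  · rfl
  · simp at hab
    exact absurd ha hab

/-- The coloring of the complete graph on `G ∪ {∞}` by sums, where `∞` is joined to `x` with
color `x + x`. -/
def sumColoring {G : Type*} [AddZeroClass G] : Option G → Option G → G
  | none, none => 0
  | none, some x => x + x
  | some x, none => x + x
  | some x, some y => x + y

theorem hasBalancedColoring_option {G : Type} [AddCommGroup G] [Fintype G] [DecidableEq G]
    (hG : ∀ x y : G, x + x = y + y → x = y) {q : ℕ}
    (hq : Fintype.card G < (q - 1) * (q - 1 - 3)) :
    HasBalancedColoring (Option G) G q := by
  have hbij : Function.Bijective fun x : G => x + x :=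
    Finite.injective_iff_bijective.1 fun x y => hG x y
  refine ⟨sumColoring, ?_, ⟨1, ?_⟩, ?_⟩
  · rintro (_ | x) (_ | y) <;> simp [sumColoring, add_comm]
  · rintro (_ | x) k <;> rw [Finset.card_eq_one]
    · obtain ⟨y, hy⟩ := hbij.2 k
      refine ⟨some y, ?_⟩
      ext (_ | z)
      · simp
      · simp only [← hy, sumColoring, Finset.mem_filter, Finset.mem_univ, true_and,
          Finset.mem_singleton, Option.some_inj]
        exact ⟨fun h => hG _ _ h.2, by rintro rfl; simp⟩
    · by_cases hk : x + x = k
      · refine ⟨none, ?_⟩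
        ext (_ | z)
        · rw [Finset.mem_filter]; simp [sumColoring, hk]
        · rw [Finset.mem_filter]; simp [sumColoring, ← hk, eq_comm]
      · refine ⟨some (k - x), ?_⟩
        ext (_ | z)
        · rw [Finset.mem_filter]; simp [sumColoring, hk]
        · rw [Finset.mem_filter]
          simp only [sumColoring, Finset.mem_univ, true_and,
            Finset.mem_singleton, Option.some_inj, ne_eq, eq_sub_iff_add_eq, add_comm x z]
          refine ⟨And.right, fun h => ⟨?_, h⟩⟩
          rintro rfl
          exact hk h
  · rintro ⟨S, hS, hr⟩
    have hT : IsRainbow (fun x y : G => x + y) S.eraseNone := by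
      intro a ha b hb a' ha' b' hb' hab hab' h
      simpa using hr a (by simpa using ha) b (by simpa using hb) a' (by simpa using ha')
        b' (by simpa using hb') (by simpa using hab) (by simpa using hab') h
    have hcard : q - 1 ≤ S.eraseNone.card := by
      rw [← hS, ← Finset.card_map (s := S.eraseNone) .some, Finset.map_some_eraseNone]
      exact Finset.pred_card_le_card_erase
    have := hT.card_mul_le hG
    exact absurd ((Nat.mul_le_mul hcard (Nat.sub_le_sub_right hcard 3)).trans this)
      (not_le.2 hq)

theorem card_sub_one_eq_of_balanced {V C : Type*} [Fintype V] [DecidableEq V] [Fintype C]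
    [DecidableEq C] (c : V → V → C) (v : V) {d : ℕ}
    (hd : ∀ k, (Finset.univ.filter fun u => u ≠ v ∧ c v u = k).card = d) :
    Fintype.card V - 1 = Fintype.card C * d := by
  have h := Finset.card_eq_sum_card_fiberwise (f := c v) (s := Finset.univ.erase v)
    (t := Finset.univ) fun _ _ => Finset.mem_coe.2 (Finset.mem_univ _)
  rw [Finset.card_erase_of_mem (Finset.mem_univ v), Finset.card_univ] at h
  rw [h, ← Finset.card_univ, ← smul_eq_mul, ← Finset.sum_const]
  refine Finset.sum_congr rfl fun k _ => ?_
  rw [← hd k]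
  congr 1
  ext u
  simp

theorem odd_choose_two {q : ℕ} (hmod : q % 4 = 2 ∨ q % 4 = 3) : Odd (q * (q - 1) / 2) := by
  obtain ⟨m, rfl | rfl⟩ : ∃ m, q = 4 * m + 2 ∨ q = 4 * m + 3 := ⟨q / 4, by omega⟩
  · have : (4 * m + 2) * (4 * m + 2 - 1) = 2 * (2 * (4 * m ^ 2 + 3 * m) + 1) := by
      rw [show 4 * m + 2 - 1 = 4 * m + 1 by omega]; ring
    rw [this, Nat.mul_div_cancel_left _ two_pos]
    exact odd_two_mul_add_one _
  · have : (4 * m + 3) * (4 * m + 3 - 1) = 2 * (2 * (4 * m ^ 2 + 5 * m + 1) + 1) := by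
      rw [show 4 * m + 3 - 1 = 4 * m + 2 by omega]; ring
    rw [this, Nat.mul_div_cancel_left _ two_pos]
    exact odd_two_mul_add_one _

theorem no_rainbow_clique_balanced_coloring
    (q : ℕ) (hq : 10 ≤ q) (hmod : q % 4 = 2 ∨ q % 4 = 3)
    (k : ℕ) (hk : 1 ≤ k) :
    ∃ c : Fin ((q * (q - 1) / 2 + 1) ^ k) → Fin ((q * (q - 1) / 2 + 1) ^ k) →
        Fin (q * (q - 1) / 2),
      (∀ a b, c a b = c b a) ∧ IsCompletelyBalanced c ∧ ¬ HasRainbowClique c q := by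
  have hodd := odd_choose_two hmod
  have hlt : q * (q - 1) / 2 < (q - 1) * (q - 1 - 3) := by
    obtain ⟨m, rfl⟩ := Nat.exists_eq_add_of_le hq
    rw [Nat.div_lt_iff_lt_mul two_pos, show 10 + m - 1 = m + 9 by omega,
      show m + 9 - 3 = m + 6 by omega]
    nlinarith
  generalize q * (q - 1) / 2 = l at *
  have : NeZero l := ⟨by rintro rfl; simp at hodd⟩
  have hdouble : ∀ x y : ZMod l, x + x = y + y → x = y := by
    intro x y h
    have h2 : IsUnit (2 : ZMod l) :=
      (ZMod.isUnit_iff_coprime 2 l).2 (Nat.coprime_two_left.2 hodd)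
    rw [← two_mul, ← two_mul] at h
    exact h2.mul_left_cancel h
  have hbase : HasBalancedColoring (Fin (l + 1)) (Fin l) q :=
    (hasBalancedColoring_option hdouble (by rwa [ZMod.card])).congr
      (Fintype.equivFinOfCardEq (by simp [ZMod.card]))
      (Fintype.equivFinOfCardEq (ZMod.card l))
  have hpow : HasBalancedColoring (Fin ((l + 1) ^ k)) (Fin l) q := by
    induction k, hk using Nat.le_induction with
    | base => exact hbase.congr (finCongr (pow_one _).symm) (Equiv.refl _)
    | succ k _ ih =>
      exact (ih.prod hbase).congr
        (finProdFinEquiv.trans (finCongr (pow_succ _ _).symm)) (Equiv.refl _)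
  obtain ⟨c, hsymm, ⟨d, hd⟩, hr⟩ := hpow
  refine ⟨c, hsymm, ⟨d, ?_, hd⟩, hr⟩
  have := card_sub_one_eq_of_balanced c ⟨0, by positivity⟩ (hd _)
  simpa using this
end

section
/- Let n, m, q ≥ 3 be integers, let C be a set of colors, and let c₁ and c₂ be edge-colorings of K_n and K_m respectively, both with colors from C, such that neither c₁ nor c₂ contains a rainbow copy of K_q. Then the lexicographical product coloring c₁×c₂ of the complete graph on nm vertices contains no rainbow copy of K_q. -/
/-- The lexicographical product coloring of the complete graph on vertex set `[n] × [m]`: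
the edge between distinct `(i₁,j₁)` and `(i₂,j₂)` gets color `c₁ i₁ i₂` if `i₁ ≠ i₂`,
and color `c₂ j₁ j₂` if `i₁ = i₂`. -/
def lexProd {n m : ℕ} {C : Type*} (c₁ : Fin n → Fin n → C) (c₂ : Fin m → Fin m → C) :
    Fin n × Fin m → Fin n × Fin m → C :=
  fun p p' => if p.1 = p'.1 then c₂ p.2 p'.2 else c₁ p.1 p'.1

/-- A map that is injective on `S` and preserves colors sends a rainbow clique to a rainbow
clique. -/
theorem HasRainbowClique.of_injOn {V W C : Type*} [DecidableEq W] {c : V → V → C}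
    {d : W → W → C} {S : Finset V} (hS : IsRainbow c S) (f : V → W) (hf : Set.InjOn f S)
    (hc : ∀ a ∈ S, ∀ b ∈ S, a ≠ b → c a b = d (f a) (f b)) :
    HasRainbowClique d S.card := by
  refine ⟨S.image f, Finset.card_image_of_injOn hf, ?_⟩
  simp only [IsRainbow, Finset.forall_mem_image]
  intro a ha b hb a' ha' b' hb' hab hab' h
  have hne : a ≠ b := fun e => hab (congrArg f e)
  have hne' : a' ≠ b' := fun e => hab' (congrArg f e)
  rw [← hc a ha b hb hne, ← hc a' ha' b' hb' hne'] at h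
  rcases hS a ha b hb a' ha' b' hb' hne hne' h with ⟨rfl, rfl⟩ | ⟨rfl, rfl⟩
  · exact Or.inl ⟨rfl, rfl⟩
  · exact Or.inr ⟨rfl, rfl⟩

/-- In a rainbow set of the lexicographical product, if two distinct vertices share their first
coordinate, then all vertices do. -/
theorem IsRainbow.fst_eq_of_lexProd {n m : ℕ} {C : Type*} {c₁ : Fin n → Fin n → C}
    {c₂ : Fin m → Fin m → C} {S : Finset (Fin n × Fin m)} (hS : IsRainbow (lexProd c₁ c₂) S)
    {p p' r : Fin n × Fin m} (hp : p ∈ S) (hp' : p' ∈ S) (hr : r ∈ S) (hne : p ≠ p')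
    (h : p.1 = p'.1) : r.1 = p.1 := by
  by_contra hrp
  have hpr : p ≠ r := fun e => hrp (congrArg Prod.fst e.symm)
  have hpr' : p' ≠ r := fun e => hrp ((congrArg Prod.fst e.symm).trans h.symm)
  rcases hS p hp r hr p' hp' r hr hpr hpr' (by simp [lexProd, ← h, Ne.symm hrp]) with ⟨e, -⟩ | ⟨e, -⟩
  · exact hne e
  · exact hpr e

theorem lexProd_no_rainbow_clique
    (n m q : ℕ) (hn : 3 ≤ n) (hm : 3 ≤ m) (hq : 3 ≤ q) {C : Type*}
    (c₁ : Fin n → Fin n → C) (c₂ : Fin m → Fin m → C)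
    (h₁s : ∀ a b, c₁ a b = c₁ b a) (h₂s : ∀ a b, c₂ a b = c₂ b a)
    (h₁ : ¬ HasRainbowClique c₁ q) (h₂ : ¬ HasRainbowClique c₂ q) :
    ¬ HasRainbowClique (lexProd c₁ c₂) q := by
  rintro ⟨S, rfl, hS⟩
  by_cases hinj : Set.InjOn Prod.fst (S : Set (Fin n × Fin m))
  · refine h₁ (.of_injOn hS Prod.fst hinj fun a ha b hb hab => ?_)
    exact if_neg fun e => hab (hinj ha hb e)
  · simp only [Set.InjOn, not_forall] at hinj
    obtain ⟨p, hp, p', hp', h, hne⟩ := hinj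
    have hfst : ∀ a ∈ S, a.1 = p.1 := fun a ha => hS.fst_eq_of_lexProd hp hp' ha hne h
    refine h₂ (.of_injOn hS Prod.snd (fun a ha b hb hab => ?_) fun a ha b hb _ => ?_)
    · exact Prod.ext ((hfst a ha).trans (hfst b hb).symm) hab
    · exact if_pos ((hfst a ha).trans (hfst b hb).symm)
end

section
/- Let n, q ≥ 3 and ℓ ≥ 1 be integers. If there exists a completely balanced edge-coloring of the complete graph K_n with ℓ colors containing no rainbow copy of K_q, then for every integer k ≥ 1 there exists a completely balanced edge-coloring of the complete graph K_{n^k} with ℓ colors containing no rainbow copy of K_q. -/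
/-- The lexicographic product of two edge-colorings: pairs with distinct first coordinates are
colored by `c₁`, pairs with a common first coordinate by `c₂`. -/
def lexColoring {A B C : Type*} [DecidableEq A] (c₁ : A → A → C) (c₂ : B → B → C)
    (x y : A × B) : C :=
  if x.1 = y.1 then c₂ x.2 y.2 else c₁ x.1 y.1

theorem IsRainbow.hasRainbowClique_of_injOn {V W C : Type*} {c : V → V → C} {c' : W → W → C}
    {S : Finset V} (hS : IsRainbow c S) (f : V → W) (hf : Set.InjOn f S)
    (hc : ∀ a ∈ S, ∀ b ∈ S, a ≠ b → c a b = c' (f a) (f b)) :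
    HasRainbowClique c' S.card := by
  classical
  refine ⟨S.image f, Finset.card_image_of_injOn hf, ?_⟩
  simp only [IsRainbow, Finset.forall_mem_image]
  intro a ha b hb a' ha' b' hb' hab hab' h
  have hab₁ : a ≠ b := fun e => hab (congrArg f e)
  have hab₂ : a' ≠ b' := fun e => hab' (congrArg f e)
  rw [← hc a ha b hb hab₁, ← hc a' ha' b' hb' hab₂] at h
  rcases hS a ha b hb a' ha' b' hb' hab₁ hab₂ h with ⟨rfl, rfl⟩ | ⟨rfl, rfl⟩ <;> simp

theorem HasRainbowClique.of_lexColoring {A B C : Type*} [DecidableEq A] {c₁ : A → A → C}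
    {c₂ : B → B → C} {q : ℕ} (h : HasRainbowClique (lexColoring c₁ c₂) q) :
    HasRainbowClique c₁ q ∨ HasRainbowClique c₂ q := by
  obtain ⟨S, rfl, hS⟩ := h
  by_cases hinj : Set.InjOn Prod.fst (S : Set (A × B))
  · refine .inl (hS.hasRainbowClique_of_injOn Prod.fst hinj fun a ha b hb hab => ?_)
    exact if_neg fun e => hab (hinj ha hb e)
  · simp only [Set.InjOn, not_forall] at hinj
    obtain ⟨x, hx, y, hy, hxy, hne⟩ := hinj
    have hfst : ∀ z ∈ S, z.1 = x.1 := by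
      intro z hz
      by_contra hzx
      have hzy : z.1 ≠ y.1 := hxy ▸ hzx
      have hcol : lexColoring c₁ c₂ z x = lexColoring c₁ c₂ z y := by
        simp only [lexColoring, if_neg hzy, hxy]
      rcases hS z hz x hx z hz y hy (fun e => hzx (congrArg _ e))
        (fun e => hzy (congrArg _ e)) hcol with ⟨-, e⟩ | ⟨e, -⟩
      · exact hne e
      · exact hzy (congrArg _ e)
    refine .inr (hS.hasRainbowClique_of_injOn Prod.snd (fun a ha b hb hab => ?_)
      fun a ha b hb _ => ?_)
    · exact Prod.ext ((hfst a ha).trans (hfst b hb).symm) hab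
    · exact if_pos ((hfst a ha).trans (hfst b hb).symm)

theorem card_filter_lexColoring {A B C : Type*} [Fintype A] [Fintype B] [DecidableEq A]
    [DecidableEq B] [DecidableEq C] (c₁ : A → A → C) (c₂ : B → B → C) (v : A × B) (k : C) :
    (Finset.univ.filter fun u => u ≠ v ∧ lexColoring c₁ c₂ v u = k).card =
      (Finset.univ.filter fun b => b ≠ v.2 ∧ c₂ v.2 b = k).card +
      (Finset.univ.filter fun a => a ≠ v.1 ∧ c₁ v.1 a = k).card * Fintype.card B := by
  have hsplit : (Finset.univ.filter fun u => u ≠ v ∧ lexColoring c₁ c₂ v u = k) =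
      ({v.1} ×ˢ Finset.univ.filter fun b => b ≠ v.2 ∧ c₂ v.2 b = k) ∪
      ((Finset.univ.filter fun a => a ≠ v.1 ∧ c₁ v.1 a = k) ×ˢ Finset.univ) := by
    ext ⟨a, b⟩
    by_cases hav : a = v.1
    · simp [lexColoring, hav, Prod.ext_iff]
    · simp [lexColoring, hav, Ne.symm hav, Prod.ext_iff]
  rw [hsplit, Finset.card_union_of_disjoint, Finset.card_product, Finset.card_product,
    Finset.card_singleton, one_mul, Finset.card_univ]
  rw [Finset.disjoint_left]
  rintro ⟨a, b⟩ h h'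
  simp only [Finset.mem_product, Finset.mem_singleton, Finset.mem_filter] at h h'
  exact h'.1.2.1 h.1

theorem IsCompletelyBalanced.lexColoring {m n l : ℕ} (hm : 0 < m) (hn : 0 < n)
    {c₁ : Fin m → Fin m → Fin l} {c₂ : Fin n → Fin n → Fin l}
    (h₁ : IsCompletelyBalanced c₁) (h₂ : IsCompletelyBalanced c₂) :
    IsCompletelyBalanced fun x y : Fin (m * n) =>
      lexColoring c₁ c₂ (finProdFinEquiv.symm x) (finProdFinEquiv.symm y) := by
  obtain ⟨d₁, hd₁, hc₁⟩ := h₁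
  obtain ⟨d₂, hd₂, hc₂⟩ := h₂
  refine ⟨d₂ + d₁ * n, ?_, fun v k => ?_⟩
  · obtain rfl : m = l * d₁ + 1 := by omega
    obtain rfl : n = l * d₂ + 1 := by omega
    rw [Nat.sub_eq_iff_eq_add (Nat.mul_pos hm hn)]
    ring
  · have h := card_filter_lexColoring c₁ c₂ (finProdFinEquiv.symm v) k
    rw [hc₁, hc₂, Fintype.card_fin] at h
    rw [← h]
    exact Finset.card_equiv finProdFinEquiv.symm fun u => by
      simp only [Finset.mem_filter_univ, ne_eq, EmbeddingLike.apply_eq_iff_eq]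

theorem iterated_balanced_coloring
    (n q l : ℕ) (hn : 3 ≤ n) (hq : 3 ≤ q) (hl : 1 ≤ l)
    (h : ∃ c : Fin n → Fin n → Fin l,
      (∀ a b, c a b = c b a) ∧ IsCompletelyBalanced c ∧ ¬ HasRainbowClique c q)
    (k : ℕ) (hk : 1 ≤ k) :
    ∃ c : Fin (n ^ k) → Fin (n ^ k) → Fin l,
      (∀ a b, c a b = c b a) ∧ IsCompletelyBalanced c ∧ ¬ HasRainbowClique c q := by
  induction k, hk using Nat.le_induction with
  | base => rwa [pow_one]
  | succ k _ ih =>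
    obtain ⟨c₁, hs₁, hb₁, hr₁⟩ := ih
    obtain ⟨c₂, hs₂, hb₂, hr₂⟩ := h
    rw [pow_succ]
    refine ⟨_, fun a b => ?_, hb₁.lexColoring (by positivity) (by omega) hb₂, ?_⟩
    · simp only [lexColoring, hs₁ (finProdFinEquiv.symm a).1, hs₂ (finProdFinEquiv.symm a).2,
        eq_comm (a := (finProdFinEquiv.symm a).1)]
    · rintro ⟨S, rfl, hS⟩
      have hlex := hS.hasRainbowClique_of_injOn (c' := lexColoring c₁ c₂) finProdFinEquiv.symm
        finProdFinEquiv.symm.injective.injOn fun _ _ _ _ _ => rfl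
      exact hlex.of_lexColoring.elim hr₁ hr₂
end

section
/- Let ℓ ≥ 3 be an odd integer and let c be the coloring of the complete graph on vertex set {0,1,…,ℓ} defined by c(i,j) = i+j (mod ℓ) for 0 ≤ i < j ≤ ℓ−1 and c(i,ℓ) = 2i (mod ℓ). If S ⊆ {0,1,…,ℓ} is a rainbow set under c (all edges within S receive pairwise distinct colors) and ℓ ∈ S, then S \ {ℓ}, viewed as a subset of Z_ℓ, is a 2-Sidon set in Z_ℓ. -/
/-- The edge-coloring of the complete graph on vertex set `{0,1,…,ℓ}` with colors in
`ZMod ℓ`: `c(i,j) = i + j (mod ℓ)` for `0 ≤ i < j ≤ ℓ-1` and `c(i,ℓ) = 2i (mod ℓ)`. -/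
def col (l : ℕ) (i j : Fin (l + 1)) : ZMod l :=
  if (i : ℕ) = l then 2 * ((j : ℕ) : ZMod l)
  else if (j : ℕ) = l then 2 * ((i : ℕ) : ZMod l)
  else ((i : ℕ) : ZMod l) + ((j : ℕ) : ZMod l)

/-- In a rainbow set containing the vertex `l`, a sum of two other vertices, possibly equal,
determines the two summands up to order. -/
theorem IsRainbow.eq_or_swap_of_add_eq {l : ℕ} {S : Finset (Fin (l + 1))}
    (hrb : IsRainbow (col l) S) (hlS : Fin.last l ∈ S) {a b a' b' : Fin (l + 1)}
    (ha : a ∈ S.erase (Fin.last l)) (hb : b ∈ S.erase (Fin.last l))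
    (ha' : a' ∈ S.erase (Fin.last l)) (hb' : b' ∈ S.erase (Fin.last l))
    (h : ((a : ℕ) : ZMod l) + ((b : ℕ) : ZMod l) = ((a' : ℕ) : ZMod l) + ((b' : ℕ) : ZMod l)) :
    (a = a' ∧ b = b') ∨ (a = b' ∧ b = a') := by
  -- the edge `{a, b}`, or `{a, l}` when `a = b`, has color `a + b`
  have edge : ∀ {a b : Fin (l + 1)}, a ∈ S.erase (Fin.last l) → b ∈ S.erase (Fin.last l) →
      ∃ e ∈ S, a ≠ e ∧ col l a e = ((a : ℕ) : ZMod l) + ((b : ℕ) : ZMod l) ∧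
        (a = b ∧ e = Fin.last l ∨ e = b) := by
    intro a b ha hb
    rw [Finset.mem_erase] at ha hb
    have hal : (a : ℕ) ≠ l := fun h => ha.1 (Fin.ext h)
    have hbl : (b : ℕ) ≠ l := fun h => hb.1 (Fin.ext h)
    by_cases hab : a = b
    · subst hab
      exact ⟨Fin.last l, hlS, ha.1, by simp [col, hal, two_mul], .inl ⟨rfl, rfl⟩⟩
    · exact ⟨b, hb.2, hab, by simp [col, hal, hbl], .inr rfl⟩
  obtain ⟨e, he, hae, hce, hbe⟩ := edge ha hb
  obtain ⟨e', he', hae', hce', hbe'⟩ := edge ha' hb'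
  have key := hrb a (Finset.mem_of_mem_erase ha) e he a' (Finset.mem_of_mem_erase ha') e' he'
    hae hae' (hce.trans (h.trans hce'.symm))
  have := Finset.ne_of_mem_erase ha
  have := Finset.ne_of_mem_erase hb
  have := Finset.ne_of_mem_erase ha'
  have := Finset.ne_of_mem_erase hb'
  grind

theorem rainbow_with_center_is_sidon
    (l : ℕ) (hl : 3 ≤ l) (hodd : Odd l)
    (S : Finset (Fin (l + 1))) (hrb : IsRainbow (col l) S)
    (hlS : (⟨l, Nat.lt_succ_self l⟩ : Fin (l + 1)) ∈ S) :
    ∀ x : ZMod l,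
      ((((S.erase ⟨l, Nat.lt_succ_self l⟩).image fun a : Fin (l + 1) => ((a : ℕ) : ZMod l)) ×ˢ
        ((S.erase ⟨l, Nat.lt_succ_self l⟩).image fun a : Fin (l + 1) => ((a : ℕ) : ZMod l))).filter
          fun p => p.1 + p.2 = x).card ≤ 2 := by
  intro x
  rcases Finset.eq_empty_or_nonempty
    ((((S.erase ⟨l, Nat.lt_succ_self l⟩).image fun a : Fin (l + 1) => ((a : ℕ) : ZMod l)) ×ˢ
      ((S.erase ⟨l, Nat.lt_succ_self l⟩).image fun a : Fin (l + 1) => ((a : ℕ) : ZMod l))).filter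
        fun p => p.1 + p.2 = x) with hempty | ⟨p, hp⟩
  · simp [hempty]
  · refine (Finset.card_le_card (t := {p, p.swap}) fun q hq => ?_).trans Finset.card_le_two
    simp only [Finset.mem_filter, Finset.mem_product, Finset.mem_image] at hp hq
    obtain ⟨p₁, p₂⟩ := p
    obtain ⟨q₁, q₂⟩ := q
    obtain ⟨⟨⟨a, ha, rfl⟩, ⟨b, hb, rfl⟩⟩, hpx⟩ := hp
    obtain ⟨⟨⟨a', ha', rfl⟩, ⟨b', hb', rfl⟩⟩, hqx⟩ := hq
    rcases hrb.eq_or_swap_of_add_eq hlS ha' hb' ha hb (hqx.trans hpx.symm) with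
      ⟨rfl, rfl⟩ | ⟨rfl, rfl⟩ <;> simp
end

section
/- Let ℓ ≥ 3 be an odd integer, let m = ⌊√ℓ + 7/2⌋, and let c be the coloring of the complete graph on vertex set {0,1,…,ℓ} defined by c(i,j) = i+j (mod ℓ) for 0 ≤ i < j ≤ ℓ−1 and c(i,ℓ) = 2i (mod ℓ). Then c contains no rainbow copy of K_m, i.e., there is no set of m vertices all of whose connecting edges receive pairwise distinct colors. -/
theorem IsRainbow.mono {V C : Type*} {c : V → V → C} {S T : Finset V} (hT : IsRainbow c T)
    (h : S ⊆ T) : IsRainbow c S :=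
  fun a ha b hb a' ha' b' hb' => hT a (h ha) b (h hb) a' (h ha') b' (h hb')

/-- In a set with distinct sums of distinct pairs, differences `a - b` with `2 b - a` outside the
set are distinct. If each `b` is the midpoint for at most `t` elements `a`, this bounds the size
of the set. -/
theorem IsRainbow.card_mul_le_s9 {G : Type*} [AddCommGroup G] [Fintype G] [DecidableEq G]
    {A : Finset G} (h : IsRainbow (fun a b : G => a + b) A) (t : ℕ)
    (ht : ∀ b ∈ A, ((A.erase b).filter fun a => b + b - a ∈ A).card ≤ t) :
    A.card * (A.card - 1 - t) ≤ Fintype.card G := by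
  set P : Finset (Σ _ : G, G) :=
    A.sigma fun b => (A.erase b).filter fun a => b + b - a ∉ A with hP
  have hlower : A.card * (A.card - 1 - t) ≤ P.card := by
    rw [hP, Finset.card_sigma, ← smul_eq_mul]
    refine Finset.card_nsmul_le_sum _ _ _ fun b hb => ?_
    have h1 := Finset.card_filter_add_card_filter_not (s := A.erase b) (fun a => b + b - a ∈ A)
    rw [Finset.card_erase_of_mem hb] at h1
    have h2 := ht b hb
    omega
  refine hlower.trans (Finset.card_le_card_of_injOn (t := Finset.univ)
    (fun p => p.2 - p.1) (fun _ _ => Finset.mem_coe.2 (Finset.mem_univ _)) ?_)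
  rintro ⟨b, a⟩ hp ⟨d, c⟩ hq hpq
  simp only [hP, Finset.coe_sigma, Set.mem_sigma_iff, Finset.mem_coe, Finset.mem_filter,
    Finset.mem_erase] at hp hq hpq
  obtain ⟨hb, ⟨hab, ha⟩, hna⟩ := hp
  obtain ⟨hd, ⟨hcd, hc⟩, hnc⟩ := hq
  have hsum : a + d = c + b := sub_eq_sub_iff_add_eq_add.1 hpq
  have had : a ≠ d := by
    rintro rfl
    exact hnc (by rwa [hsum, add_sub_cancel_left])
  have hcb : c ≠ b := by
    rintro rfl
    exact hna (by rwa [← hsum, add_sub_cancel_left])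
  rcases h a ha d hd c hc b hb had hcb hsum with ⟨rfl, rfl⟩ | ⟨hab', -⟩
  · rfl
  · exact absurd hab' hab

theorem IsRainbow.card_midpoint_le_two {G : Type*} [AddCommGroup G] [DecidableEq G]
    {A : Finset G} (h : IsRainbow (fun a b : G => a + b) A)
    (hinj : ∀ a b : G, a + a = b + b → a = b) {b : G} :
    ((A.erase b).filter fun a => b + b - a ∈ A).card ≤ 2 := by
  have hne : ∀ a, a ≠ b → a ≠ b + b - a := fun a hab e =>
    hab (hinj a b (eq_sub_iff_add_eq.1 e))
  rcases ((A.erase b).filter fun a => b + b - a ∈ A).eq_empty_or_nonempty with h0 | ⟨x, hx⟩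
  · simp [h0]
  · refine (Finset.card_le_card (t := {x, b + b - x}) fun y hy => ?_).trans Finset.card_le_two
    simp only [Finset.mem_filter, Finset.mem_erase] at hx hy
    rcases h y hy.1.2 _ hy.2 x hx.1.2 _ hx.2 (hne y hy.1.1) (hne x hx.1.1)
      (by simp) with ⟨e, -⟩ | ⟨e, -⟩ <;> simp [e]

theorem ZMod.eq_of_add_self_eq {l : ℕ} (hodd : Odd l) (a b : ZMod l) (h : a + a = b + b) :
    a = b := by
  have hu : IsUnit ((2 : ℕ) : ZMod l) :=
    (ZMod.isUnit_iff_coprime 2 l).2 (Nat.coprime_two_left.2 hodd)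
  refine hu.mul_left_cancel ?_
  push_cast
  rw [two_mul, two_mul, h]

theorem ZMod.natCast_injOn_fin (l : ℕ) :
    Set.InjOn (fun i : Fin (l + 1) => ((i : ℕ) : ZMod l)) {i | i ≠ Fin.last l} := by
  intro i hi j hj h
  have hi' := Fin.val_lt_last hi
  have hj' := Fin.val_lt_last hj
  have := (ZMod.natCast_eq_natCast_iff' _ _ _).1 h
  rw [Nat.mod_eq_of_lt hi', Nat.mod_eq_of_lt hj'] at this
  exact Fin.ext this

theorem col_of_ne_last {l : ℕ} {i j : Fin (l + 1)} (hi : i ≠ Fin.last l) (hj : j ≠ Fin.last l) :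
    col l i j = ((i : ℕ) : ZMod l) + ((j : ℕ) : ZMod l) := by
  rw [col, if_neg (Fin.val_lt_last hi).ne, if_neg (Fin.val_lt_last hj).ne]

theorem col_last_right {l : ℕ} {i : Fin (l + 1)} (hi : i ≠ Fin.last l) :
    col l i (Fin.last l) = ((i : ℕ) : ZMod l) + ((i : ℕ) : ZMod l) := by
  rw [col, if_neg (Fin.val_lt_last hi).ne, if_pos (Fin.val_last l), two_mul]

theorem IsRainbow.image_natCast {l : ℕ} {S : Finset (Fin (l + 1))} (h : IsRainbow (col l) S)
    (hS : Fin.last l ∉ S) :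
    IsRainbow (fun a b : ZMod l => a + b) (S.image fun i : Fin (l + 1) => ((i : ℕ) : ZMod l)) := by
  have hl : ∀ i ∈ S, i ≠ Fin.last l := fun i hi e => hS (e ▸ hi)
  simp only [IsRainbow, Finset.forall_mem_image]
  intro a ha b hb c hc d hd hab hcd he
  rw [← col_of_ne_last (hl a ha) (hl b hb), ← col_of_ne_last (hl c hc) (hl d hd)] at he
  rcases h a ha b hb c hc d hd (fun e => hab (e ▸ rfl)) (fun e => hcd (e ▸ rfl)) he with
    ⟨rfl, rfl⟩ | ⟨rfl, rfl⟩ <;> simp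

theorem card_image_natCast {l : ℕ} {S : Finset (Fin (l + 1))} (hS : Fin.last l ∉ S) :
    (S.image fun i : Fin (l + 1) => ((i : ℕ) : ZMod l)).card = S.card :=
  Finset.card_image_of_injOn <| (ZMod.natCast_injOn_fin l).mono
    fun i hi (e : i = Fin.last l) => hS (e ▸ hi)

/-- If the vertex `ℓ` belongs to a rainbow set, the other vertices contain no three-term
arithmetic progression. -/
theorem IsRainbow.card_midpoint_eq_zero {l : ℕ} {S : Finset (Fin (l + 1))}
    (h : IsRainbow (col l) S) (hS : Fin.last l ∈ S) (hodd : Odd l) :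
    ∀ b ∈ (S.erase (Fin.last l)).image fun i : Fin (l + 1) => ((i : ℕ) : ZMod l),
      ((((S.erase (Fin.last l)).image fun i : Fin (l + 1) => ((i : ℕ) : ZMod l)).erase b).filter
        fun a => b + b - a ∈ (S.erase (Fin.last l)).image fun i : Fin (l + 1) => ((i : ℕ) : ZMod l)).card
      ≤ 0 := by
  intro b hb
  rw [Nat.le_zero, Finset.card_eq_zero, Finset.filter_eq_empty_iff]
  intro a ha hc
  rw [Finset.mem_erase] at ha
  obtain ⟨hab, ha⟩ := ha
  obtain ⟨i, hi, rfl⟩ := Finset.mem_image.1 hb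
  obtain ⟨j, hj, rfl⟩ := Finset.mem_image.1 ha
  obtain ⟨k, hk, hke⟩ := Finset.mem_image.1 hc
  rw [Finset.mem_erase] at hi hj hk
  have hjk : j ≠ k := by
    rintro rfl
    exact hab (ZMod.eq_of_add_self_eq hodd _ _ (eq_sub_iff_add_eq.1 hke))
  have hcol : col l j k = col l i (Fin.last l) := by
    rw [col_of_ne_last hj.1 hk.1, col_last_right hi.1, hke]
    abel
  rcases h j hj.2 k hk.2 i hi.2 _ hS hjk hi.1 hcol with ⟨-, e⟩ | ⟨e, -⟩
  · exact hk.1 e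
  · exact hj.1 e

theorem col_no_rainbow_clique (l : ℕ) (hl : 3 ≤ l) (hodd : Odd l) :
    ¬ HasRainbowClique (col l) (⌊Real.sqrt l + 7 / 2⌋₊) := by
  rintro ⟨S, hcard, hS⟩
  have : NeZero l := ⟨by omega⟩
  have hl' : (3 : ℝ) ≤ l := by exact_mod_cast hl
  have hsq : Real.sqrt l ^ 2 = l := Real.sq_sqrt (by positivity)
  have hs : (3 / 2 : ℝ) ≤ Real.sqrt l := Real.le_sqrt_of_sq_le (by linarith)
  have h5 : 5 ≤ S.card := hcard ▸ Nat.le_floor (by push_cast; linarith)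
  have hlt : Real.sqrt l + 7 / 2 < (S.card : ℝ) + 1 := hcard ▸ Nat.lt_floor_add_one _
  obtain ⟨n, hn⟩ := Nat.exists_eq_add_of_le h5
  have hlt' : (l : ℝ) < (n + 5 / 2) ^ 2 := by
    rw [hn] at hlt
    push_cast at hlt
    nlinarith
  by_cases hlast : Fin.last l ∈ S
  · have hnot := Finset.notMem_erase (Fin.last l) S
    have key := ((hS.mono (Finset.erase_subset (Fin.last l) S)).image_natCast hnot).card_mul_le_s9 0
      (hS.card_midpoint_eq_zero hlast hodd)
    rw [card_image_natCast hnot, Finset.card_erase_of_mem hlast, ZMod.card, hn,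
      show 5 + n - 1 - 1 - 0 = n + 3 by omega, show 5 + n - 1 = n + 4 by omega] at key
    have key' : ((n : ℝ) + 4) * (n + 3) ≤ l := by exact_mod_cast key
    nlinarith
  · have hA := hS.image_natCast hlast
    have key := hA.card_mul_le_s9 2
      fun b _ => hA.card_midpoint_le_two (ZMod.eq_of_add_self_eq hodd)
    rw [card_image_natCast hlast, ZMod.card, hn,
      show 5 + n - 1 - 2 = n + 2 by omega] at key
    have key' : (5 + (n : ℝ)) * (n + 2) ≤ l := by exact_mod_cast key
    nlinarith
end
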